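/- Let M = {w : ℕ → {1,2,3,4} : w(n) ≠ w(n+1) for all n} be the space of codes of points of the Apollonian net, and for i ∈ {1,2,3,4} define γ_i : M → M by γ_i(iw) = w and γ_i(w) = iw when the first letter of w is not i. Then each γ_i is a well-defined involution of M different from the identity, and the homomorphism from the free product (ℤ/2ℤ) ∗ (ℤ/2ℤ) ∗ (ℤ/2ℤ) ∗ (ℤ/2ℤ) to the symmetric group of M sending the generator of the i-th free factor to γ_i is injective; in particular the group Γ = ⟨γ₁, γ₂, γ₃, γ₄⟩ is isomorphic to the free product of four groups of order 2. -/

import Mathlib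

/-- The space of codes of points of the Apollonian net: sequences over `{1,2,3,4}`
with no two equal consecutive letters. -/
def ApSpace : Type := {w : ℕ → Fin 4 // ∀ n, w n ≠ w (n + 1)}

/-- The transformation `γ_i`: it deletes the first letter if that letter equals `i`,
and prepends the letter `i` otherwise. -/
def apGamma (i : Fin 4) (w : ApSpace) : ApSpace :=
  if h : w.val 0 = i then
    ⟨fun n => w.val (n + 1), fun n => w.prop (n + 1)⟩
  else
    ⟨fun n => match n with | 0 => i | k + 1 => w.val k, by
      intro n
      match n with
      | 0 => exact fun hh => h hh.symm
      | k + 1 => exact w.prop k⟩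

theorem apGamma_head_of_ne {i : Fin 4} {w : ApSpace} (h : w.val 0 ≠ i) :
    (apGamma i w).val 0 = i := by
  simp [apGamma, h]

theorem apGamma_head_ne (i : Fin 4) (w : ApSpace) : (apGamma i w).val 0 ≠ w.val 0 := by
  by_cases h : w.val 0 = i
  · simpa [apGamma, h] using fun h' => w.prop 0 (h.trans h'.symm)
  · rw [apGamma_head_of_ne h]
    exact fun h' => h h'.symm

theorem apGamma_involutive (i : Fin 4) : Function.Involutive (apGamma i) := by
  intro w
  apply Subtype.ext
  funext n
  by_cases h : w.val 0 = i
  · have h' : w.val 1 ≠ i := fun h' => w.prop 0 (h.trans h'.symm)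
    cases n <;> simp [apGamma, h, h']
  · simp [apGamma, h]

theorem exists_code_head (a : Fin 4) : ∃ v : ApSpace, v.val 0 = a := by
  refine ⟨⟨fun n => if Even n then a else a + 1, fun n => ?_⟩, by simp⟩
  by_cases h : Even n <;> simp [h, Nat.even_add_one]

theorem apGamma_ne_id (i : Fin 4) : apGamma i ≠ id := by
  intro h
  obtain ⟨v, -⟩ := exists_code_head i
  exact apGamma_head_ne i v (by rw [h]; rfl)

theorem eq_empty_of_fstIdx_eq_none {ι : Type*} {M : ι → Type*} [∀ i, Monoid (M i)]
    {w : Monoid.CoprodI.Word M} (h : w.fstIdx = none) : w = Monoid.CoprodI.Word.empty := by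
  apply Monoid.CoprodI.Word.ext
  simpa [Monoid.CoprodI.Word.fstIdx] using h

/-- A reduced word maps every code avoiding a suitable first letter to a code that starts
with the index of the first letter of the word. -/
theorem exists_letter_map_prod
    (φ : Monoid.CoprodI (fun _ : Fin 4 => Multiplicative (ZMod 2)) →* Function.End ApSpace)
    (hφ : ∀ i : Fin 4,
      φ (Monoid.CoprodI.of (i := i) (Multiplicative.ofAdd (1 : ZMod 2))) = apGamma i)
    (w : Monoid.CoprodI.Word (fun _ : Fin 4 => Multiplicative (ZMod 2))) :
    ∃ j : Fin 4, ∀ v : ApSpace, v.val 0 ≠ j →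
      ∀ i, w.fstIdx = some i → (φ w.prod v).val 0 = i := by
  induction w using Monoid.CoprodI.Word.consRecOn with
  | empty => exact ⟨0, fun v _ i hi => by simp [Monoid.CoprodI.Word.fstIdx] at hi⟩
  | cons i m w hw hm ih =>
    have hm' : m = Multiplicative.ofAdd (1 : ZMod 2) := by
      revert m; decide
    subst hm'
    have key (v : ApSpace) :
        φ (Monoid.CoprodI.Word.cons _ w hw hm).prod v = apGamma i (φ w.prod v) := by
      rw [Monoid.CoprodI.Word.prod_cons, map_mul, hφ]
      rfl
    simp only [Monoid.CoprodI.Word.fstIdx_cons, Option.some.injEq, forall_eq', key]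
    cases hf : w.fstIdx with
    | none =>
      refine ⟨i, fun v hv => apGamma_head_of_ne ?_⟩
      rw [eq_empty_of_fstIdx_eq_none hf, Monoid.CoprodI.Word.prod_empty, map_one]
      exact hv
    | some k =>
      obtain ⟨j, hj⟩ := ih
      refine ⟨j, fun v hv => apGamma_head_of_ne ?_⟩
      rw [hj v hv k hf]
      rintro rfl
      exact hw hf

/-- Each `γ_i` is a non-trivial involution of the space of codes, and the homomorphism
from the free product `(ℤ/2ℤ) ∗ (ℤ/2ℤ) ∗ (ℤ/2ℤ) ∗ (ℤ/2ℤ)` to the transformations of the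
code space sending the generator of the `i`-th factor to `γ_i` is injective; so the group
generated by `γ₁, γ₂, γ₃, γ₄` is the free product of four groups of order 2. -/
theorem apollonian_free_product :
    (∀ i : Fin 4, Function.Involutive (apGamma i) ∧ apGamma i ≠ id) ∧
    (∀ φ : Monoid.CoprodI (fun _ : Fin 4 => Multiplicative (ZMod 2)) →* Function.End ApSpace,
      (∀ i : Fin 4,
        φ (Monoid.CoprodI.of (i := i) (Multiplicative.ofAdd (1 : ZMod 2))) = apGamma i) →
      Function.Injective φ) := by
  refine ⟨fun i => ⟨apGamma_involutive i, apGamma_ne_id i⟩, fun φ hφ => ?_⟩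
  rw [injective_iff_map_eq_one]
  intro x hx
  obtain ⟨w, rfl⟩ := Monoid.CoprodI.Word.equiv.symm.surjective x
  change φ w.prod = 1 at hx
  change w.prod = 1
  obtain ⟨j, hj⟩ := exists_letter_map_prod φ hφ w
  cases hw : w.fstIdx with
  | none =>
    rw [eq_empty_of_fstIdx_eq_none hw, Monoid.CoprodI.Word.prod_empty]
  | some i =>
    obtain ⟨a, haj, hai⟩ : ∃ a : Fin 4, a ≠ j ∧ a ≠ i := by
      clear hj hw; revert i j; decide
    obtain ⟨v, rfl⟩ := exists_code_head a
    have h := hj v haj i hw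
    rw [hx] at h
    exact absurd h hai
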